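/- arXiv:2203.01410 — 2 statements merged into one kernel-verified Lean document; each statement's English description precedes it below -/
import Mathlib

section
/- Let A be the 6×6 real matrix with rows (0,1,0,0,0,0), (1.000002542612694, 0, 0, 2, 0, 0), (0,0,0,1,0,0), (0, -0.000294117647059, 0, 0, 0, 0), (0,0,0,0,0,1), (0,0,0,0,-0.00000127311747,0), and let B be the 6×1 column vector (0,0,0,0,0,1)ᵀ (a single thruster in the axial z-direction). Then the Kalman controllability matrix Q = [B, AB, A²B, A³B, A⁴B, A⁵B], viewed as a 6×6 real matrix, has rank 2; in particular its rank is strictly less than 6. -/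
/-- Linearized satellite dynamics matrix under the `J₂` zonal harmonic. -/
def A : Matrix (Fin 6) (Fin 6) ℝ :=
  !![0, 1, 0, 0, 0, 0;
     1.000002542612694, 0, 0, 2, 0, 0;
     0, 0, 0, 1, 0, 0;
     0, -0.000294117647059, 0, 0, 0, 0;
     0, 0, 0, 0, 0, 1;
     0, 0, 0, 0, -0.00000127311747, 0]

/-- Input matrix: thruster columns. -/
def B : Matrix (Fin 6) (Fin 1) ℝ :=
  !![0;
     0;
     0;
     0;
     0;
     1]

/-- Kalman controllability matrix `Q = [B, AB, A²B, A³B, A⁴B, A⁵B]`,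
viewed as a `6 × 6` real matrix with columns indexed by `Fin 6 × Fin 1`. -/
def Q : Matrix (Fin 6) (Fin 6 × Fin 1) ℝ :=
  Matrix.of fun i p => (A ^ (p.1 : ℕ) * B) i p.2

/-- The inclusion of the axial `(z, ż)`-plane into the state space. -/
def axialInclusion : Matrix (Fin 6) (Fin 2) ℝ :=
  !![0, 0; 0, 0; 0, 0; 0, 0; 1, 0; 0, 1]

/-- The axial block of `A`. -/
def axialBlock : Matrix (Fin 2) (Fin 2) ℝ :=
  !![0, 1; -0.00000127311747, 0]

/-- The axial part of `B`. -/
def axialInput : Matrix (Fin 2) (Fin 1) ℝ :=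
  !![0; 1]

theorem A_mul_axialInclusion : A * axialInclusion = axialInclusion * axialBlock := by
  ext i j
  fin_cases i <;> fin_cases j <;>
    simp [A, axialInclusion, axialBlock, Matrix.mul_apply, Fin.sum_univ_succ]

theorem B_eq_axialInclusion_mul : B = axialInclusion * axialInput := by
  ext i j
  fin_cases i <;> fin_cases j <;> simp [B, axialInclusion, axialInput]

theorem A_pow_mul_B (k : ℕ) : A ^ k * B = axialInclusion * (axialBlock ^ k * axialInput) := by
  induction k with
  | zero => simpa using B_eq_axialInclusion_mul
  | succ k ih =>
    rw [pow_succ', Matrix.mul_assoc, ih, ← Matrix.mul_assoc, A_mul_axialInclusion,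
      Matrix.mul_assoc, ← Matrix.mul_assoc axialBlock, ← pow_succ']

theorem Q_eq_axialInclusion_mul :
    Q = axialInclusion *
      Matrix.of fun i (p : Fin 6 × Fin 1) => (axialBlock ^ (p.1 : ℕ) * axialInput) i p.2 := by
  ext i p
  rw [Q, Matrix.of_apply, A_pow_mul_B, Matrix.mul_apply, Matrix.mul_apply]
  rfl

theorem rank_Q_le_two : Q.rank ≤ 2 := by
  rw [Q_eq_axialInclusion_mul]
  exact (Matrix.rank_mul_le_left _ _).trans (Matrix.rank_le_width _)

theorem submatrix_Q_eq_one :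
    Q.submatrix ![4, 5] ![((1 : Fin 6), (0 : Fin 1)), (0, 0)] = (1 : Matrix (Fin 2) (Fin 2) ℝ) := by
  ext i j
  fin_cases i <;> fin_cases j <;>
    simp [Q, A, B, Matrix.mul_apply, Fin.sum_univ_succ]

theorem two_le_rank_Q : 2 ≤ Q.rank := by
  have h := Matrix.rank_submatrix_le Q ![4, 5] ![((1 : Fin 6), (0 : Fin 1)), (0, 0)]
  rwa [submatrix_Q_eq_one, Matrix.rank_one, Fintype.card_fin] at h

theorem kalman_rank_z : Q.rank = 2 ∧ Q.rank < 6 := by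
  have h : Q.rank = 2 := le_antisymm rank_Q_le_two two_le_rank_Q
  exact ⟨h, by omega⟩
end

section
/- Let A be the 6×6 real matrix with rows (0,1,0,0,0,0), (1.000002542612694, 0, 0, 2, 0, 0), (0,0,0,1,0,0), (0, -0.000294117647059, 0, 0, 0, 0), (0,0,0,0,0,1), (0,0,0,0,-0.00000127311747,0), and let B be the 6×1 column vector (0,0,0,0,0,1)ᵀ (a single thruster in the axial z-direction). Then the linear control system ẋ(t) = A x(t) + B u(t) is not controllable: for every t₀ < t₁ in ℝ there exists a target state x₁ ∈ ℝ⁶ such that for every continuous control u : ℝ → ℝ and every differentiable trajectory x : ℝ → ℝ⁶ satisfying x′(t) = A x(t) + B u(t) for all t and x(t₀) = 0, one has x(t₁) ≠ x₁. -/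
theorem not_controllable_z :
    ∀ t₀ t₁ : ℝ, t₀ < t₁ →
      ∃ x₁ : Fin 6 → ℝ, ∀ u : ℝ → ℝ, Continuous u →
        ∀ x : ℝ → Fin 6 → ℝ,
          (∀ t : ℝ, HasDerivAt x (A.mulVec (x t) + B.mulVec (fun _ => u t)) t) →
          x t₀ = 0 → x t₁ ≠ x₁ := by
  intro t₀ t₁ _
  refine ⟨Pi.single 3 1, fun u _ x hx h₀ h₁ => ?_⟩
  -- The angular momentum component `x₃ + c x₀` is conserved, whatever the control.
  have hd (t : ℝ) : HasDerivAt (fun s => x s 3 + 0.000294117647059 * x s 0) 0 t := by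
    have h := hasDerivAt_pi.1 (hx t)
    refine ((h 3).add ((h 0).const_mul 0.000294117647059)).congr_deriv ?_
    simp [A, B, dotProduct, Fin.sum_univ_succ]
  have hc := is_const_of_deriv_eq_zero (fun t => (hd t).differentiableAt)
    (fun t => (hd t).deriv) t₀ t₁
  simp [h₀, h₁] at hc
end
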